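/- Let 1 < p < ∞. The space 𝓜_p fails the lower Pythagorean inequality for every exponent r > 1 and constant K > 0: for every r > 1 and K > 0 there exist x, y ∈ 𝓜_p with x ⊥_{𝓜_p} y (Birkhoff–James orthogonality) and ‖x‖_{𝓜_p}^r + K‖y‖_{𝓜_p}^r > ‖x+y‖_{𝓜_p}^r; witnesses are x = 1+z and y = c(1−z) for real c > 0. -/

import Mathlib

open ComplexConjugate
open scoped ENNReal

noncomputable section

/-- Cauchy product of coefficient sequences (multiplication of power series). -/
def cauchyMul (f g : ℕ → ℂ) : ℕ → ℂ :=
  fun n => ∑ k ∈ Finset.range (n + 1), f k * g (n - k)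

/-- Membership in `ℓᵖ_A`: the coefficient sequence is `p`-summable (`p` finite). -/
def MemLpA (p : ℝ) (f : ℕ → ℂ) : Prop :=
  Summable fun k => ‖f k‖ ^ p

/-- The `ℓᵖ` norm of a coefficient sequence (`p` finite). -/
def pNorm (p : ℝ) (f : ℕ → ℂ) : ℝ :=
  (∑' k, ‖f k‖ ^ p) ^ (1 / p)

/-- `φ` is a multiplier of `ℓᵖ_A`. -/
def IsMultiplier (p : ℝ) (φ : ℕ → ℂ) : Prop :=
  ∀ f : ℕ → ℂ, MemLpA p f → MemLpA p (cauchyMul φ f)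

/-- The multiplier norm of `φ`, i.e. the operator norm of multiplication by `φ` on `ℓᵖ_A`. -/
def multNorm (p : ℝ) (φ : ℕ → ℂ) : ℝ :=
  sSup { x : ℝ | ∃ f : ℕ → ℂ, MemLpA p f ∧ pNorm p f ≤ 1 ∧ x = pNorm p (cauchyMul φ f) }

/-- The coefficient sequence of the polynomial `a + b z`. -/
def affineSeq (a b : ℂ) : ℕ → ℂ :=
  fun n => if n = 0 then a else if n = 1 then b else 0

/-- The coefficient sequence of `z f(z)`. -/
def shiftSeq (f : ℕ → ℂ) : ℕ → ℂ
  | 0 => 0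
  | n + 1 => f n

lemma cauchyMul_affineSeq (a b : ℂ) (f : ℕ → ℂ) (n : ℕ) :
    cauchyMul (affineSeq a b) f n = a * f n + b * shiftSeq f n := by
  cases n with
  | zero => simp [cauchyMul, affineSeq, shiftSeq]
  | succ n =>
    rw [cauchyMul, Finset.sum_range_succ', Finset.sum_range_succ']
    simp [affineSeq, shiftSeq, add_comm]

lemma hasSum_shiftSeq {p : ℝ} (hp : 0 < p) {f : ℕ → ℂ} (hf : MemLpA p f) :
    HasSum (fun k => ‖shiftSeq f k‖ ^ p) (∑' k, ‖f k‖ ^ p) := by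
  rw [← hasSum_nat_add_iff' 1]
  simpa [shiftSeq, Real.zero_rpow hp.ne'] using hf.hasSum

lemma pNorm_nonneg (p : ℝ) (f : ℕ → ℂ) : 0 ≤ pNorm p f :=
  Real.rpow_nonneg (tsum_nonneg fun _ => by positivity) _

lemma pNorm_shiftSeq {p : ℝ} (hp : 0 < p) {f : ℕ → ℂ} (hf : MemLpA p f) :
    pNorm p (shiftSeq f) = pNorm p f := by
  rw [pNorm, (hasSum_shiftSeq hp hf).tsum_eq, pNorm]

lemma tsum_const_mul_rpow {p : ℝ} (hp : 0 < p) (a : ℂ) (f : ℕ → ℂ) :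
    (∑' k, (‖a‖ * ‖f k‖) ^ p) ^ (1 / p) = ‖a‖ * pNorm p f := by
  simp_rw [Real.mul_rpow (norm_nonneg a) (norm_nonneg _), tsum_mul_left]
  rw [Real.mul_rpow (by positivity) (tsum_nonneg fun _ => by positivity), one_div,
    Real.rpow_rpow_inv (norm_nonneg a) hp.ne', pNorm, one_div]

lemma memLpA_cauchyMul_affineSeq_and_pNorm_le {p : ℝ} (hp : 1 < p) (a b : ℂ) {f : ℕ → ℂ}
    (hf : MemLpA p f) :
    MemLpA p (cauchyMul (affineSeq a b) f) ∧
      pNorm p (cauchyMul (affineSeq a b) f) ≤ (‖a‖ + ‖b‖) * pNorm p f := by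
  have hp0 : 0 < p := by linarith
  have hF : Summable fun k => (‖a‖ * ‖f k‖) ^ p := by
    simp_rw [Real.mul_rpow (norm_nonneg a) (norm_nonneg _)]
    exact hf.mul_left _
  have hG : Summable fun k => (‖b‖ * ‖shiftSeq f k‖) ^ p := by
    simp_rw [Real.mul_rpow (norm_nonneg b) (norm_nonneg _)]
    exact (hasSum_shiftSeq hp0 hf).summable.mul_left _
  obtain ⟨hsum, hle⟩ := Real.Lp_add_le_tsum_of_nonneg hp.le (fun k => by positivity)
    (fun k => by positivity) hF hG
  have hpt (k : ℕ) : ‖cauchyMul (affineSeq a b) f k‖ ^ p ≤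
      (‖a‖ * ‖f k‖ + ‖b‖ * ‖shiftSeq f k‖) ^ p := by
    rw [cauchyMul_affineSeq, ← norm_mul, ← norm_mul]
    exact Real.rpow_le_rpow (norm_nonneg _) (norm_add_le _ _) hp0.le
  have hmem : MemLpA p (cauchyMul (affineSeq a b) f) :=
    hsum.of_nonneg_of_le (fun k => by positivity) hpt
  refine ⟨hmem, ?_⟩
  rw [tsum_const_mul_rpow hp0, tsum_const_mul_rpow hp0, pNorm_shiftSeq hp0 hf,
    ← add_mul] at hle
  refine le_trans ?_ hle
  exact Real.rpow_le_rpow (tsum_nonneg fun k => by positivity)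
    (hmem.tsum_le_tsum hpt hsum) (by positivity)

lemma isMultiplier_affineSeq {p : ℝ} (hp : 1 < p) (a b : ℂ) : IsMultiplier p (affineSeq a b) :=
  fun _ hf => (memLpA_cauchyMul_affineSeq_and_pNorm_le hp a b hf).1

lemma pNorm_cauchyMul_affineSeq_le {p : ℝ} (hp : 1 < p) (a b : ℂ) {f : ℕ → ℂ}
    (hf : MemLpA p f) (hf1 : pNorm p f ≤ 1) :
    pNorm p (cauchyMul (affineSeq a b) f) ≤ ‖a‖ + ‖b‖ :=
  (memLpA_cauchyMul_affineSeq_and_pNorm_le hp a b hf).2.trans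
    (mul_le_of_le_one_right (by positivity) hf1)

lemma multNorm_affineSeq_le {p : ℝ} (hp : 1 < p) (a b : ℂ) :
    multNorm p (affineSeq a b) ≤ ‖a‖ + ‖b‖ := by
  refine Real.sSup_le ?_ (by positivity)
  rintro _ ⟨f, hf, hf1, rfl⟩
  exact pNorm_cauchyMul_affineSeq_le hp a b hf hf1

lemma pNorm_le_multNorm_affineSeq {p : ℝ} (hp : 1 < p) (a b : ℂ) {f : ℕ → ℂ}
    (hf : MemLpA p f) (hf1 : pNorm p f ≤ 1) :
    pNorm p (cauchyMul (affineSeq a b) f) ≤ multNorm p (affineSeq a b) := by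
  refine le_csSup ⟨‖a‖ + ‖b‖, ?_⟩ ⟨f, hf, hf1, rfl⟩
  rintro _ ⟨g, hg, hg1, rfl⟩
  exact pNorm_cauchyMul_affineSeq_le hp a b hg hg1

/-- The normalised truncation of the geometric sequence `ω ^ k`. -/
def truncGeom (p : ℝ) (ω : ℂ) (M : ℕ) : ℕ → ℂ :=
  fun k => if k < M + 1 then ω ^ k * (((M + 1 : ℝ) ^ (-(1 / p)) : ℝ) : ℂ) else 0

lemma inv_rpow_rpow {p : ℝ} (hp : 0 < p) (M : ℕ) :
    ((M + 1 : ℝ) ^ (-(1 / p))) ^ p = (M + 1 : ℝ)⁻¹ := by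
  rw [← Real.rpow_mul (by positivity), neg_mul, one_div_mul_cancel hp.ne', Real.rpow_neg_one]

lemma hasSum_truncGeom {p : ℝ} (hp : 0 < p) {ω : ℂ} (hω : ‖ω‖ = 1) (M : ℕ) :
    HasSum (fun k => ‖truncGeom p ω M k‖ ^ p) 1 := by
  have h : HasSum (fun k => ‖truncGeom p ω M k‖ ^ p)
      (∑ k ∈ Finset.range (M + 1), ‖truncGeom p ω M k‖ ^ p) := by
    refine hasSum_sum_of_ne_finset_zero fun k hk => ?_
    rw [Finset.mem_range] at hk
    simp [truncGeom, hk, Real.zero_rpow hp.ne']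
  convert h using 1
  have h' : ∀ k ∈ Finset.range (M + 1), ‖truncGeom p ω M k‖ ^ p = (M + 1 : ℝ)⁻¹ := by
    intro k hk
    rw [Finset.mem_range] at hk
    rw [truncGeom, if_pos hk, norm_mul, norm_pow, hω, one_pow, one_mul, Complex.norm_real,
      Real.norm_of_nonneg (by positivity), inv_rpow_rpow hp]
  rw [Finset.sum_congr rfl h', Finset.sum_const, Finset.card_range, nsmul_eq_mul]
  push_cast
  field_simp

lemma norm_cauchyMul_affineSeq_truncGeom {p : ℝ} (hp : 0 < p) (a b : ℂ) {ω : ℂ}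
    (hω : ‖ω‖ = 1) {M k : ℕ} (hk : k < M) :
    ‖cauchyMul (affineSeq a b) (truncGeom p ω M) (k + 1)‖ ^ p =
      ‖a * ω + b‖ ^ p * (M + 1 : ℝ)⁻¹ := by
  have h : cauchyMul (affineSeq a b) (truncGeom p ω M) (k + 1) =
      (a * ω + b) * ω ^ k * (((M + 1 : ℝ) ^ (-(1 / p)) : ℝ) : ℂ) := by
    rw [cauchyMul_affineSeq, shiftSeq, truncGeom, truncGeom, if_pos (by omega), if_pos (by omega)]
    ring
  rw [h, norm_mul, norm_mul, norm_pow, hω, one_pow, mul_one, Complex.norm_real,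
    Real.norm_of_nonneg (by positivity), Real.mul_rpow (by positivity) (by positivity),
    inv_rpow_rpow hp]

lemma le_multNorm_affineSeq {p : ℝ} (hp : 1 < p) (a b : ℂ) {ω : ℂ} (hω : ‖ω‖ = 1) :
    ‖a * ω + b‖ ≤ multNorm p (affineSeq a b) := by
  have hp0 : 0 < p := by linarith
  have hbound (M : ℕ) :
      ‖a * ω + b‖ * ((M : ℝ) / (M + 1)) ^ (1 / p) ≤ multNorm p (affineSeq a b) := by
    have hs := hasSum_truncGeom hp0 hω M
    have hmem : MemLpA p (truncGeom p ω M) := hs.summable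
    have hn : pNorm p (truncGeom p ω M) = 1 := by
      rw [pNorm, hs.tsum_eq, Real.one_rpow]
    refine le_trans ?_ (pNorm_le_multNorm_affineSeq hp a b hmem hn.le)
    have hprod : MemLpA p (cauchyMul (affineSeq a b) (truncGeom p ω M)) :=
      isMultiplier_affineSeq hp a b _ hmem
    have hsum : ‖a * ω + b‖ ^ p * ((M : ℝ) / (M + 1)) ≤
        ∑' k, ‖cauchyMul (affineSeq a b) (truncGeom p ω M) k‖ ^ p := by
      refine le_trans ?_ (hprod.sum_le_tsum (Finset.range (M + 1)) fun k _ => by positivity)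
      rw [Finset.sum_range_succ', Finset.sum_congr rfl fun k hk =>
        norm_cauchyMul_affineSeq_truncGeom hp0 a b hω (Finset.mem_range.mp hk),
        Finset.sum_const, Finset.card_range, nsmul_eq_mul]
      refine le_add_of_le_of_nonneg (le_of_eq ?_) (by positivity)
      ring
    calc ‖a * ω + b‖ * ((M : ℝ) / (M + 1)) ^ (1 / p)
        = (‖a * ω + b‖ ^ p * ((M : ℝ) / (M + 1))) ^ (1 / p) := by
          rw [Real.mul_rpow (by positivity) (by positivity), one_div,
            Real.rpow_rpow_inv (norm_nonneg _) hp0.ne']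
      _ ≤ _ := Real.rpow_le_rpow (by positivity) hsum (by positivity)
  have hlim : Filter.Tendsto (fun M : ℕ => ‖a * ω + b‖ * ((M : ℝ) / (M + 1)) ^ (1 / p))
      Filter.atTop (nhds ‖a * ω + b‖) := by
    have h := ((tendsto_natCast_div_add_atTop (1 : ℝ)).rpow_const
      (p := 1 / p) (Or.inl one_ne_zero)).const_mul ‖a * ω + b‖
    simpa using h
  exact le_of_tendsto' hlim hbound

/-- `𝓜_p` fails the lower Pythagorean inequality for every `r > 1` and `K > 0`; witnesses are
`x = 1 + z` and `y = c(1 - z)` for suitable real `c > 0`. -/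
theorem multiplier_space_fails_lower_pythagoras (p : ℝ) (hp : 1 < p)
    (r K : ℝ) (hr : 1 < r) (hK : 0 < K) :
    ∃ x y : ℕ → ℂ, IsMultiplier p x ∧ IsMultiplier p y ∧
      (∃ c : ℝ, 0 < c ∧
        x = (fun n => if n = 0 then (1 : ℂ) else if n = 1 then 1 else 0) ∧
        y = (fun n => if n = 0 then (c : ℂ) else if n = 1 then -(c : ℂ) else 0)) ∧
      (∀ β : ℂ, multNorm p x ≤ multNorm p (fun n => x n + β * y n)) ∧
      multNorm p x ^ r + K * multNorm p y ^ r > multNorm p (fun n => x n + y n) ^ r := by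
  have hx : multNorm p (affineSeq 1 1) = 2 := by
    refine le_antisymm ((multNorm_affineSeq_le hp 1 1).trans_eq (by norm_num)) ?_
    have h := le_multNorm_affineSeq hp 1 1 (ω := 1) (by simp)
    norm_num at h
    exact h
  have hy : 0 < multNorm p (affineSeq 1 (-1)) := by
    have h := le_multNorm_affineSeq hp 1 (-1) (ω := -1) (by simp)
    norm_num at h
    linarith
  have hcomb (β : ℂ) : (fun n => affineSeq 1 1 n + β * affineSeq 1 (-1) n) =
      affineSeq (1 + β) (1 - β) := by
    funext n
    simp only [affineSeq]
    split_ifs <;> ring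
  have hxy : multNorm p (fun n => affineSeq 1 1 n + affineSeq 1 (-1) n) = 2 := by
    have h1 := hcomb 1
    simp only [one_mul] at h1
    rw [h1]
    refine le_antisymm ((multNorm_affineSeq_le hp (1 + 1) (1 - 1)).trans_eq (by norm_num)) ?_
    have h := le_multNorm_affineSeq hp (1 + 1) (1 - 1) (ω := 1) (by simp)
    norm_num at h
    norm_num
    exact h
  refine ⟨affineSeq 1 1, affineSeq 1 (-1), isMultiplier_affineSeq hp _ _,
    isMultiplier_affineSeq hp _ _, ⟨1, one_pos, rfl, ?_⟩, fun β => ?_, ?_⟩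
  · funext n
    simp only [affineSeq, Complex.ofReal_one]
  · rw [hx, hcomb]
    have h := le_multNorm_affineSeq hp (1 + β) (1 - β) (ω := 1) (by simp)
    have h2 : (1 + β) * 1 + (1 - β) = 2 := by ring
    rwa [h2, Complex.norm_ofNat] at h
  · rw [hx, hxy]
    have : 0 < K * multNorm p (affineSeq 1 (-1)) ^ r := by positivity
    linarith
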